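/- Let g : ℝ^m → ℝ^m be Lipschitz with constant L > 0 and set φ = id + g. Then for every integer k ≥ 1 and every z ∈ ℝ^m, with C = ((1+L)^k − 1 − kL)/L, one has the two-sided bound (k − C)·‖φ(z) − z‖ ≤ ‖φ^k(z) − z‖ ≤ (k + C)·‖φ(z) − z‖. -/

import Mathlib

/-- For `φ = id + g` with `g` Lipschitz with constant `L`, the displacement of `φ^[k]` at `z` differs
from `k • g z` by at most `((1 + L) ^ k - 1 - k * L) / L * ‖g z‖`. -/
theorem norm_iterate_sub_sub_smul_le {E : Type*} [NormedAddCommGroup E] [NormedSpace ℝ E]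
    {g φ : E → E} {L : ℝ} (hL : 0 < L) (hg : ∀ x y, ‖g x - g y‖ ≤ L * ‖x - y‖)
    (hφ : ∀ z, φ z = z + g z) (k : ℕ) (z : E) :
    ‖φ^[k] z - z - (k : ℝ) • g z‖ ≤ ((1 + L) ^ k - 1 - k * L) / L * ‖g z‖ := by
  induction k with
  | zero => simp
  | succ k ih =>
    set w := φ^[k] z with hw
    have hsplit : φ^[k + 1] z - z - ((k + 1 : ℕ) : ℝ) • g z
        = (w - z - (k : ℝ) • g z) + (g w - g z) := by
      rw [Function.iterate_succ_apply', hφ, ← hw]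
      push_cast
      module
    have hdisp : ‖w - z‖ ≤ ((1 + L) ^ k - 1 - k * L) / L * ‖g z‖ + k * ‖g z‖ := by
      calc ‖w - z‖ = ‖(w - z - (k : ℝ) • g z) + (k : ℝ) • g z‖ := by rw [sub_add_cancel]
        _ ≤ ‖w - z - (k : ℝ) • g z‖ + ‖(k : ℝ) • g z‖ := norm_add_le _ _
        _ ≤ _ := by
          rw [norm_smul, Real.norm_natCast]
          gcongr
    rw [hsplit]
    calc ‖(w - z - (k : ℝ) • g z) + (g w - g z)‖
        ≤ ‖w - z - (k : ℝ) • g z‖ + ‖g w - g z‖ := norm_add_le _ _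
      _ ≤ ((1 + L) ^ k - 1 - k * L) / L * ‖g z‖
          + L * (((1 + L) ^ k - 1 - k * L) / L * ‖g z‖ + k * ‖g z‖) := by
        gcongr
        exact (hg w z).trans (by gcongr)
      _ = _ := by
        push_cast
        field_simp
        ring


/-- Inequality (4.2): for `φ = id + g` with `g` Lipschitz with constant `L`, the
displacement of the `k`-th iterate satisfies the two-sided bound
`(k − C)‖φ(z) − z‖ ≤ ‖φ^k(z) − z‖ ≤ (k + C)‖φ(z) − z‖` with
`C = ((1+L)^k − 1 − kL)/L`. -/
theorem iterate_displacement_two_sided_bound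
    (m : ℕ) (g : EuclideanSpace ℝ (Fin m) → EuclideanSpace ℝ (Fin m))
    (L : ℝ) (hL : 0 < L)
    (hg : ∀ x y, ‖g x - g y‖ ≤ L * ‖x - y‖)
    (φ : EuclideanSpace ℝ (Fin m) → EuclideanSpace ℝ (Fin m))
    (hφ : ∀ z, φ z = z + g z)
    (k : ℕ) (hk : 1 ≤ k) (z : EuclideanSpace ℝ (Fin m)) :
    ((k : ℝ) - ((1 + L) ^ k - 1 - k * L) / L) * ‖φ z - z‖ ≤ ‖φ^[k] z - z‖ ∧
    ‖φ^[k] z - z‖ ≤ ((k : ℝ) + ((1 + L) ^ k - 1 - k * L) / L) * ‖φ z - z‖ := by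
  have hdisp : φ z - z = g z := by rw [hφ, add_sub_cancel_left]
  have hdiff := norm_iterate_sub_sub_smul_le hL hg hφ k z
  have hnorm : ‖(k : ℝ) • g z‖ = k * ‖g z‖ := by rw [norm_smul, Real.norm_natCast]
  have hlower := norm_sub_norm_le ((k : ℝ) • g z) (φ^[k] z - z)
  have hupper := norm_sub_norm_le (φ^[k] z - z) ((k : ℝ) • g z)
  rw [norm_sub_rev ((k : ℝ) • g z)] at hlower
  rw [hdisp, sub_mul, add_mul]
  constructor <;> linarith
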